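/- Let t ≥ 55 and m ≥ n ≥ t, and let G = (X, V, E) be a random left t-regular bipartite graph with |X| = n, |V| = m. Let V' = {v ∈ V : deg(v) ≥ 6t} and let G' be the induced bipartite subgraph on (X, V'). Then Pr[G' contains a cycle] ≤ 2·t⁴·e^{−t} ≤ 2^{−t}. -/

import Mathlib

open Finset

open scoped Classical

/-- The sample space of a random left `t`-regular bipartite graph on parts
`X = Fin n` and `V = Fin m`: each `x ∈ X` independently gets a uniformly random
`t`-element neighborhood `Γ x ⊆ V`. The uniform distribution on this finite set
is the distribution of the random graph. -/
noncomputable def regChoices (n m t : ℕ) : Finset (Fin n → Finset (Fin m)) :=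
  Finset.univ.filter fun Γ => ∀ x, (Γ x).card = t

/-- The degree of a right vertex `v ∈ V`. -/
noncomputable def rightDeg {n m : ℕ} (Γ : Fin n → Finset (Fin m)) (v : Fin m) : ℕ :=
  (Finset.univ.filter fun x : Fin n => v ∈ Γ x).card

/-- The bipartite subgraph `G'` induced on `(X, V')`, where
`V' = {v ∈ V : deg(v) ≥ 6t}`: `x ∈ X` and `v ∈ V` are adjacent iff `v ∈ Γ x` and
`v ∈ V'`. -/
noncomputable def inducedGraph {n m : ℕ} (Γ : Fin n → Finset (Fin m)) (t : ℕ) :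
    SimpleGraph (Fin n ⊕ Fin m) :=
  SimpleGraph.fromRel fun a b =>
    ∃ x v, a = Sum.inl x ∧ b = Sum.inr v ∧ v ∈ Γ x ∧ 6 * t ≤ rightDeg Γ v

theorem exists_dense_of_not_isAcyclic {n m : ℕ} {Γ : Fin n → Finset (Fin m)} {t : ℕ}
    (h : ¬ (inducedGraph Γ t).IsAcyclic) :
    ∃ S : Finset (Fin m), S.Nonempty ∧ (∀ v ∈ S, 6 * t ≤ rightDeg Γ v) ∧
      S.card ≤ (univ.filter fun x => 2 ≤ (Γ x ∩ S).card).card := by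
  have adj_iff : ∀ x v, (inducedGraph Γ t).Adj (Sum.inl x) (Sum.inr v) ↔
      v ∈ Γ x ∧ 6 * t ≤ rightDeg Γ v := by
    intro x v; simp [inducedGraph]
  have not_adj_inl : ∀ x y, ¬ (inducedGraph Γ t).Adj (Sum.inl x) (Sum.inl y) := by
    intro x v; simp [inducedGraph]
  have not_adj_inr : ∀ x y, ¬ (inducedGraph Γ t).Adj (Sum.inr x) (Sum.inr y) := by
    intro x v; simp [inducedGraph]
  simp only [SimpleGraph.IsAcyclic, not_forall, not_not] at h
  obtain ⟨u, c, hc⟩ := h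
  set H := c.toSubgraph with hH
  have hdeg : ∀ w ∈ H.verts, (H.neighborSet w).ncard = 2 := fun w hw =>
    hc.ncard_neighborSet_toSubgraph_eq_two (by simpa [hH] using hw)
  set A : Finset (Fin n) := univ.filter fun x => Sum.inl x ∈ H.verts with hA
  set S : Finset (Fin m) := univ.filter fun v => Sum.inr v ∈ H.verts with hS
  have habove : ∀ x ∈ A, (S.bipartiteAbove (fun x v => H.Adj (Sum.inl x) (Sum.inr v)) x).card
      = 2 := by
    intro x hx
    rw [← hdeg (Sum.inl x) (by simpa [hA] using hx), ← Set.ncard_coe_finset,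
      ← Set.ncard_image_of_injective _ (Sum.inr_injective (α := Fin n))]
    congr 1
    ext w
    rcases w with y | v
    · simpa using fun h => not_adj_inl _ _ h.adj_sub
    · simpa [Finset.bipartiteAbove, hS] using fun h => H.edge_vert h.symm
  have hbelow : ∀ v ∈ S, (A.bipartiteBelow (fun x v => H.Adj (Sum.inl x) (Sum.inr v)) v).card
      = 2 := by
    intro v hv
    rw [← hdeg (Sum.inr v) (by simpa [hS] using hv), ← Set.ncard_coe_finset,
      ← Set.ncard_image_of_injective _ (Sum.inl_injective (β := Fin m))]
    congr 1
    ext w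
    rcases w with x | y
    · simpa [Finset.bipartiteBelow, hA, H.adj_comm (Sum.inr v)] using fun h => H.edge_vert h
    · simpa using fun h => not_adj_inr _ _ h.adj_sub
  have hcard := Finset.card_mul_eq_card_mul _ habove hbelow
  have hAS : ∀ x ∈ A, S.bipartiteAbove (fun x v => H.Adj (Sum.inl x) (Sum.inr v)) x ⊆
      Γ x ∩ S := by
    intro x _ v hv
    obtain ⟨hvS, hadj⟩ := Finset.mem_filter.mp hv
    exact Finset.mem_inter.mpr ⟨((adj_iff x v).mp hadj.adj_sub).1, hvS⟩
  refine ⟨S, ?_, ?_, ?_⟩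
  · have hu : u ∈ H.verts := by simp [hH]
    rcases u with x | v
    · have hx : x ∈ A := by simpa [hA] using hu
      have : 0 < A.card := Finset.card_pos.mpr ⟨x, hx⟩
      exact Finset.card_pos.mp (by omega)
    · exact ⟨v, by simpa [hS] using hu⟩
  · intro v hv
    obtain ⟨x, hx⟩ := Finset.card_pos.mp ((hbelow v hv).symm ▸ two_pos)
    exact ((adj_iff x v).mp (Finset.mem_filter.mp hx).2.adj_sub).2
  · have : A ⊆ univ.filter fun x => 2 ≤ (Γ x ∩ S).card := by
      intro x hx
      rw [Finset.mem_filter]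
      exact ⟨Finset.mem_univ x, (habove x hx) ▸ Finset.card_le_card (hAS x hx)⟩
    have := Finset.card_le_card this
    omega

theorem choose_sub_sub_le (j : ℕ) : ∀ {m t : ℕ}, j ≤ t → t ≤ m →
    ((m - j).choose (t - j) : ℝ) ≤ m.choose t * ((t : ℝ) / m) ^ j := by
  induction j with
  | zero => intro m t _ _; simp
  | succ j ih =>
    intro m t hjt htm
    obtain ⟨t, rfl⟩ : ∃ s, t = s + 1 := ⟨t - 1, by omega⟩
    obtain ⟨m, rfl⟩ : ∃ s, m = s + 1 := ⟨m - 1, by omega⟩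
    have htm' : (t : ℝ) ≤ m := by exact_mod_cast (by omega : t ≤ m)
    have hratio : (t : ℝ) / m ≤ ((t + 1 : ℕ) : ℝ) / ((m + 1 : ℕ) : ℝ) := by
      rcases Nat.eq_zero_or_pos m with rfl | hm
      · simp; positivity
      · have : (0 : ℝ) < m := by exact_mod_cast hm
        rw [div_le_div_iff₀ this (by positivity)]
        push_cast
        nlinarith
    have hchoose : ((m + 1).choose (t + 1) : ℝ) * (((t + 1 : ℕ) : ℝ) / ((m + 1 : ℕ) : ℝ))
        = m.choose t := by
      have := Nat.add_one_mul_choose_eq m t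
      rw [← mul_div_assoc, div_eq_iff (by positivity)]
      exact_mod_cast (by linarith : (m + 1).choose (t + 1) * (t + 1) = m.choose t * (m + 1))
    calc ((m + 1 - (j + 1)).choose (t + 1 - (j + 1)) : ℝ) = (m - j).choose (t - j) := by
          rw [Nat.add_sub_add_right, Nat.add_sub_add_right]
      _ ≤ m.choose t * ((t : ℝ) / m) ^ j := ih (by omega) (by omega)
      _ ≤ m.choose t * (((t + 1 : ℕ) : ℝ) / ((m + 1 : ℕ) : ℝ)) ^ j := by gcongr
      _ = _ := by rw [← hchoose]; ring

theorem card_powersetCard_filter_superset_le {m t : ℕ} (htm : t ≤ m) (T : Finset (Fin m)) :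
    ((((univ : Finset (Fin m)).powersetCard t).filter fun γ => T ⊆ γ).card : ℝ)
      ≤ m.choose t * ((t : ℝ) / m) ^ T.card := by
  rcases le_or_gt T.card t with hT | hT
  · refine le_trans ?_ (choose_sub_sub_le T.card hT htm)
    have : (m - T.card).choose (t - T.card) = ((Tᶜ).powersetCard (t - T.card)).card := by
      simp [Finset.card_compl]
    rw [this, Nat.cast_le]
    refine Finset.card_le_card_of_injOn (fun γ => γ \ T) ?_ ?_
    · intro γ hγ
      simp only [Finset.coe_filter, Finset.mem_powersetCard, Set.mem_ofPred_eq] at hγ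
      simp only [Finset.mem_coe, Finset.mem_powersetCard]
      refine ⟨fun v hv => by simpa using (Finset.mem_sdiff.mp hv).2, ?_⟩
      rw [Finset.card_sdiff_of_subset hγ.2, hγ.1.2]
    · intro γ hγ δ hδ h
      simp only [Finset.coe_filter, Set.mem_ofPred_eq] at hγ hδ
      rw [← Finset.sdiff_union_of_subset hγ.2, ← Finset.sdiff_union_of_subset hδ.2]
      exact congrArg (· ∪ T) h
  · rw [Finset.filter_false_of_mem]
    · simp; positivity
    · intro γ hγ hTγ
      have := Finset.card_le_card hTγ
      rw [(Finset.mem_powersetCard.mp hγ).2] at this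
      omega

theorem sum_pow_card_filter_le {ι : Type*} {p : ℝ} (hp : 0 ≤ p) (S : Finset ι) :
    ∀ r : ℕ, ∑ T ∈ S.powerset.filter (fun T => r ≤ T.card), p ^ T.card
      ≤ (S.card * p) ^ r * (1 + p) ^ S.card := by
  induction S using Finset.induction_on with
  | empty =>
    intro r
    rcases r with _ | r <;> simp [Finset.sum_filter]
  | insert a S ha ih =>
    intro r
    have hsplit : ∑ T ∈ (insert a S).powerset.filter (fun T => r ≤ T.card), p ^ T.card
        = ∑ T ∈ S.powerset.filter (fun T => r ≤ T.card), p ^ T.card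
          + p * ∑ T ∈ S.powerset.filter (fun T => r ≤ T.card + 1), p ^ T.card := by
      rw [Finset.sum_filter, Finset.sum_powerset_insert ha, Finset.mul_sum, Finset.sum_filter,
        Finset.sum_filter]
      congr 1
      refine Finset.sum_congr rfl fun T hT => ?_
      rw [Finset.card_insert_of_notMem fun h => ha (Finset.mem_powerset.mp hT h)]
      split_ifs <;> ring
    rw [hsplit, Finset.card_insert_of_notMem ha]
    push_cast
    set k : ℝ := (S.card : ℝ) with hk
    have hk0 : 0 ≤ k := Nat.cast_nonneg _
    rcases r with _ | r
    · have h0 := ih 0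
      simp only [Nat.zero_le, pow_zero, one_mul] at h0 ⊢
      rw [pow_succ]
      nlinarith
    · have h1 := ih (r + 1)
      have h2 := ih r
      simp only [Nat.add_le_add_iff_right]
      calc _ ≤ (k * p) ^ (r + 1) * (1 + p) ^ S.card + p * ((k * p) ^ r * (1 + p) ^ S.card) := by
            gcongr
        _ = k ^ r * (k + 1) * (p ^ (r + 1) * (1 + p) ^ S.card) := by ring
        _ ≤ (k + 1) ^ r * (k + 1) * (p ^ (r + 1) * (1 + p) ^ (S.card + 1)) := by
            gcongr
            · linarith
            · linarith
            · omega
        _ = _ := by rw [mul_pow]; ring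

theorem sum_card_subsets_le {m t : ℕ} (htm : t ≤ m) (S : Finset (Fin m)) (r : ℕ) :
    ∑ γ ∈ (univ : Finset (Fin m)).powersetCard t,
        (((γ ∩ S).powerset.filter fun T => r ≤ T.card).card : ℝ)
      ≤ m.choose t * ((S.card * ((t : ℝ) / m)) ^ r * (1 + (t : ℝ) / m) ^ S.card) := by
  have hcomm : ∑ γ ∈ (univ : Finset (Fin m)).powersetCard t,
        (((γ ∩ S).powerset.filter fun T => r ≤ T.card).card : ℝ)
      = ∑ T ∈ S.powerset.filter (fun T => r ≤ T.card),
        ((((univ : Finset (Fin m)).powersetCard t).filter fun γ => T ⊆ γ).card : ℝ) := by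
    have := Finset.sum_card_bipartiteAbove_eq_sum_card_bipartiteBelow
      (s := (univ : Finset (Fin m)).powersetCard t)
      (t := S.powerset.filter (fun T => r ≤ T.card)) (fun γ T => T ⊆ γ)
    rw [← Nat.cast_sum, ← Nat.cast_sum, Nat.cast_inj]
    refine Eq.trans (Finset.sum_congr rfl fun γ _ => ?_) this
    congr 1
    ext T
    simp only [Finset.bipartiteAbove, Finset.mem_filter, Finset.mem_powerset,
      Finset.subset_inter_iff]
    tauto
  rw [hcomm]
  calc _ ≤ ∑ T ∈ S.powerset.filter (fun T => r ≤ T.card),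
          (m.choose t : ℝ) * ((t : ℝ) / m) ^ T.card :=
        Finset.sum_le_sum fun T _ => card_powersetCard_filter_superset_le htm T
    _ ≤ _ := by
        rw [← Finset.mul_sum]
        gcongr
        exact sum_pow_card_filter_le (by positivity) S r

theorem two_pow_card_le_four_mul {ι : Type*} (B : Finset ι) (hB : 2 ≤ B.card) :
    2 ^ B.card ≤ 4 * (B.powerset.filter fun T => 2 ≤ T.card).card := by
  obtain ⟨C, hCB, hC⟩ := Finset.exists_subset_card_eq hB
  have h : (B \ C).powerset.card ≤ (B.powerset.filter fun T => 2 ≤ T.card).card := by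
    refine Finset.card_le_card_of_injOn (fun T => T ∪ C) ?_ ?_
    · intro T hT
      have hT' := Finset.mem_powerset.mp hT
      simp only [Finset.coe_filter, Finset.mem_powerset, Set.mem_ofPred_eq]
      exact ⟨Finset.union_subset (hT'.trans Finset.sdiff_subset) hCB,
        hC ▸ Finset.card_le_card Finset.subset_union_right⟩
    · intro T hT T' hT' h
      have disj : ∀ R ∈ (B \ C).powerset, (R ∪ C) \ C = R := fun R hR =>
        Finset.union_sdiff_cancel_right
          (Finset.disjoint_of_subset_left (Finset.mem_powerset.mp hR) Finset.sdiff_disjoint)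
      rw [← disj T hT, ← disj T' hT']
      exact congrArg (· \ C) h
  rw [Finset.card_powerset, Finset.card_sdiff_of_subset hCB, hC] at h
  calc 2 ^ B.card = 4 * 2 ^ (B.card - 2) := by
        obtain ⟨b, hb⟩ := Nat.exists_eq_add_of_le hB
        rw [hb, Nat.add_sub_cancel_left, pow_add]; norm_num
    _ ≤ _ := by gcongr

/-- The weight by which the neighborhood `γ` of a left vertex is tilted in order to control the
event that `S` consists of high-degree vertices and is hit twice by many left vertices. -/
noncomputable def tilt {m : ℕ} (S : Finset (Fin m)) (l : ℝ) (γ : Finset (Fin m)) : ℝ :=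
  2 ^ (γ ∩ S).card * (1 + if 2 ≤ (γ ∩ S).card then l else 0)

theorem sum_tilt_le {m t : ℕ} (htm : t ≤ m) (S : Finset (Fin m)) {l : ℝ} (hl : 0 ≤ l) :
    ∑ γ ∈ (univ : Finset (Fin m)).powersetCard t, tilt S l γ
      ≤ m.choose t * ((1 + (t : ℝ) / m) ^ S.card *
        (1 + 4 * l * (S.card * ((t : ℝ) / m)) ^ 2)) := by
  have hpt : ∀ γ : Finset (Fin m), tilt S l γ ≤
      (((γ ∩ S).powerset.filter fun T => 0 ≤ T.card).card : ℝ)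
        + 4 * l * ((γ ∩ S).powerset.filter fun T => 2 ≤ T.card).card := by
    intro γ
    have h0 : (((γ ∩ S).powerset.filter fun T => 0 ≤ T.card).card : ℝ) = 2 ^ (γ ∩ S).card := by
      rw [Finset.filter_true_of_mem fun _ _ => Nat.zero_le _, Finset.card_powerset]
      push_cast
      rfl
    rw [h0, tilt, mul_add, mul_one]
    refine add_le_add le_rfl ?_
    split_ifs with h
    · have : (2 : ℝ) ^ (γ ∩ S).card ≤
          4 * ((γ ∩ S).powerset.filter fun T => 2 ≤ T.card).card := by
        exact_mod_cast two_pow_card_le_four_mul _ h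
      nlinarith
    · simp only [mul_zero]; positivity
  refine (Finset.sum_le_sum fun γ _ => hpt γ).trans ?_
  rw [Finset.sum_add_distrib, ← Finset.mul_sum]
  have h0 := sum_card_subsets_le htm S 0
  have h2 := sum_card_subsets_le htm S 2
  calc _ ≤ _ + 4 * l * _ := add_le_add h0 (mul_le_mul_of_nonneg_left h2 (by positivity))
    _ = _ := by ring

theorem le_prod_tilt {n m t : ℕ} {Γ : Fin n → Finset (Fin m)} {S : Finset (Fin m)} {l : ℝ}
    (hl : 0 ≤ l) (hdeg : ∀ v ∈ S, 6 * t ≤ rightDeg Γ v)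
    (hcard : S.card ≤ (univ.filter fun x => 2 ≤ (Γ x ∩ S).card).card) :
    (2 : ℝ) ^ (6 * t * S.card) * l ^ S.card ≤ ∏ x, tilt S l (Γ x) := by
  simp only [tilt, Finset.prod_mul_distrib, Finset.prod_pow_eq_pow_sum]
  refine mul_le_mul (pow_le_pow_right₀ one_le_two ?_) ?_ (by positivity) (by positivity)
  · have hsum : ∑ x, (Γ x ∩ S).card = ∑ v ∈ S, rightDeg Γ v := by
      have := Finset.sum_card_bipartiteAbove_eq_sum_card_bipartiteBelow
        (s := (univ : Finset (Fin n))) (t := S) (fun x v => v ∈ Γ x)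
      refine Eq.trans (Finset.sum_congr rfl fun x _ => ?_) this
      rw [Finset.inter_comm, ← Finset.filter_mem_eq_inter]
      rfl
    rw [hsum, mul_comm]
    simpa using Finset.card_nsmul_le_sum S _ _ hdeg
  · calc l ^ S.card ≤ (1 + l) ^ S.card := by gcongr; linarith
      _ ≤ (1 + l) ^ (univ.filter fun x => 2 ≤ (Γ x ∩ S).card).card :=
          pow_le_pow_right₀ (by linarith) hcard
      _ = ∏ x, if 2 ≤ (Γ x ∩ S).card then 1 + l else 1 := by
          rw [← Finset.prod_filter, Finset.prod_const]
      _ = _ := Finset.prod_congr rfl fun x _ => by split_ifs <;> simp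

theorem regChoices_eq_piFinset (n m t : ℕ) :
    regChoices n m t = Fintype.piFinset fun _ => (univ : Finset (Fin m)).powersetCard t := by
  ext Γ
  simp [regChoices, Finset.mem_powersetCard]

theorem card_regChoices (n m t : ℕ) : (regChoices n m t).card = m.choose t ^ n := by
  rw [regChoices_eq_piFinset, Fintype.card_piFinset]
  simp

theorem card_dense_mul_le {n m t : ℕ} (ht : 0 < t) (htn : t ≤ n) (hnm : n ≤ m)
    {S : Finset (Fin m)} (hS : S.Nonempty) :
    (((regChoices n m t).filter fun Γ => (∀ v ∈ S, 6 * t ≤ rightDeg Γ v) ∧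
        S.card ≤ (univ.filter fun x => 2 ≤ (Γ x ∩ S).card).card).card : ℝ)
      ≤ (regChoices n m t).card *
        (4 * S.card * t ^ 2 / m * (Real.exp (t + 1) / 2 ^ (6 * t))) ^ S.card := by
  set k := S.card with hk
  have hk0 : (0 : ℝ) < k := by exact_mod_cast hS.card_pos
  have ht0 : (0 : ℝ) < t := by exact_mod_cast ht
  have hm0 : (0 : ℝ) < m := by exact_mod_cast (by omega : 0 < m)
  have hnm' : (n : ℝ) ≤ m := by exact_mod_cast hnm
  set l : ℝ := m / (4 * k * t ^ 2) with hl
  have hl0 : 0 < l := by positivity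
  set bad := (regChoices n m t).filter fun Γ => (∀ v ∈ S, 6 * t ≤ rightDeg Γ v) ∧
        k ≤ (univ.filter fun x => 2 ≤ (Γ x ∩ S).card).card with hbad
  have hmarkov : (bad.card : ℝ) * (2 ^ (6 * t * k) * l ^ k)
      ≤ (∑ γ ∈ (univ : Finset (Fin m)).powersetCard t, tilt S l γ) ^ n := by
    calc (bad.card : ℝ) * (2 ^ (6 * t * k) * l ^ k)
        = ∑ Γ ∈ bad, (2 ^ (6 * t * k) * l ^ k : ℝ) := by simp
      _ ≤ ∑ Γ ∈ bad, ∏ x, tilt S l (Γ x) := Finset.sum_le_sum fun Γ hΓ =>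
          le_prod_tilt hl0.le (Finset.mem_filter.mp hΓ).2.1 (Finset.mem_filter.mp hΓ).2.2
      _ ≤ ∑ Γ ∈ regChoices n m t, ∏ x, tilt S l (Γ x) :=
          Finset.sum_le_sum_of_subset_of_nonneg (Finset.filter_subset _ _) fun Γ _ _ =>
            Finset.prod_nonneg fun x _ => by unfold tilt; split_ifs <;> positivity
      _ = _ := by rw [regChoices_eq_piFinset, Finset.sum_pow']
  have hexp : (∑ γ ∈ (univ : Finset (Fin m)).powersetCard t, tilt S l γ) ^ n
      ≤ (regChoices n m t).card * Real.exp (t + 1) ^ k := by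
    have hsum := sum_tilt_le (htn.trans hnm) S hl0.le
    rw [← hk] at hsum
    have hlk : 4 * l * (k * ((t : ℝ) / m)) ^ 2 = k / m := by
      rw [hl]; field_simp
    rw [hlk] at hsum
    have h1 : (1 + (t : ℝ) / m) ≤ Real.exp (t / m) := by
      linarith [Real.add_one_le_exp ((t : ℝ) / m)]
    have h2 : (1 + (k : ℝ) / m) ≤ Real.exp (k / m) := by
      linarith [Real.add_one_le_exp ((k : ℝ) / m)]
    calc _ ≤ ((m.choose t : ℝ) * (Real.exp (t / m) ^ k * Real.exp (k / m))) ^ n := by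
          refine pow_le_pow_left₀ (Finset.sum_nonneg fun γ _ => ?_) (hsum.trans ?_) n
          · unfold tilt; split_ifs <;> positivity
          · gcongr
      _ = (regChoices n m t).card * Real.exp (k * (t + 1) * (n / m)) := by
          rw [card_regChoices, mul_pow, ← Real.exp_nat_mul, ← Real.exp_add, ← Real.exp_nat_mul]
          push_cast
          congr 2
          ring
      _ ≤ (regChoices n m t).card * Real.exp (k * (t + 1)) := by
          refine mul_le_mul_of_nonneg_left (Real.exp_le_exp.mpr ?_) (by positivity)
          exact mul_le_of_le_one_right (by positivity) ((div_le_one hm0).mpr hnm')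
      _ = _ := by rw [← Real.exp_nat_mul]
  have := hmarkov.trans hexp
  rw [← le_div_iff₀ (by positivity)] at this
  refine this.trans_eq ?_
  rw [hl, mul_pow, div_pow, div_pow, div_pow, pow_mul, mul_div_assoc]
  field_simp

theorem sum_card_dense_le {n m t k : ℕ} (ht : 0 < t) (htn : t ≤ n) (hnm : n ≤ m) (hk : 0 < k) :
    ∑ S ∈ (univ : Finset (Fin m)).powersetCard k,
      (((regChoices n m t).filter fun Γ => (∀ v ∈ S, 6 * t ≤ rightDeg Γ v) ∧
        S.card ≤ (univ.filter fun x => 2 ≤ (Γ x ∩ S).card).card).card : ℝ)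
      ≤ (regChoices n m t).card * (4 * t ^ 2 * (Real.exp (t + 2) / 2 ^ (6 * t))) ^ k := by
  have hm0 : (0 : ℝ) < m := by exact_mod_cast (by omega : 0 < m)
  have hterm : ∀ S ∈ (univ : Finset (Fin m)).powersetCard k,
      (((regChoices n m t).filter fun Γ => (∀ v ∈ S, 6 * t ≤ rightDeg Γ v) ∧
        S.card ≤ (univ.filter fun x => 2 ≤ (Γ x ∩ S).card).card).card : ℝ)
      ≤ (regChoices n m t).card *
        (4 * k * t ^ 2 / m * (Real.exp (t + 1) / 2 ^ (6 * t))) ^ k := by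
    intro S hS
    have hSk := (Finset.mem_powersetCard.mp hS).2
    have := card_dense_mul_le ht htn hnm (Finset.card_pos.mp (hSk ▸ hk))
    rwa [hSk] at this ⊢
  refine (Finset.sum_le_card_nsmul _ _ _ hterm).trans ?_
  rw [Finset.card_powersetCard, Finset.card_univ, Fintype.card_fin, nsmul_eq_mul]
  have hchoose : (m.choose k : ℝ) * (k / m) ^ k ≤ Real.exp 1 ^ k := by
    calc (m.choose k : ℝ) * (k / m) ^ k ≤ (m ^ k / k.factorial) * (k / m) ^ k := by
          gcongr
          exact Nat.choose_le_pow_div k m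
      _ = k ^ k / k.factorial := by rw [div_pow]; field_simp
      _ ≤ Real.exp k := Real.pow_div_factorial_le_exp _ k.cast_nonneg k
      _ = Real.exp 1 ^ k := by rw [← Real.exp_nat_mul, mul_one]
  calc (m.choose k : ℝ) * ((regChoices n m t).card *
        (4 * k * t ^ 2 / m * (Real.exp (t + 1) / 2 ^ (6 * t))) ^ k)
      = (m.choose k * (k / m) ^ k) * ((regChoices n m t).card *
        (4 * t ^ 2 * (Real.exp (t + 1) / 2 ^ (6 * t))) ^ k) := by
        rw [show (4 * k * t ^ 2 / m * (Real.exp (t + 1) / 2 ^ (6 * t)) : ℝ)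
          = (k / m) * (4 * t ^ 2 * (Real.exp (t + 1) / 2 ^ (6 * t))) by ring, mul_pow]
        ring
    _ ≤ Real.exp 1 ^ k * ((regChoices n m t).card *
        (4 * t ^ 2 * (Real.exp (t + 1) / 2 ^ (6 * t))) ^ k) := by gcongr
    _ = _ := by
        rw [show (t : ℝ) + 2 = 1 + (t + 1) by ring, Real.exp_add 1]
        rw [mul_left_comm, ← mul_pow]
        ring

theorem card_not_isAcyclic_le {n m t : ℕ} (ht : 0 < t) (htn : t ≤ n) (hnm : n ≤ m) :
    (((regChoices n m t).filter fun Γ => ¬ (inducedGraph Γ t).IsAcyclic).card : ℝ)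
      ≤ (regChoices n m t).card *
        ∑ k ∈ range m, (4 * t ^ 2 * (Real.exp (t + 2) / 2 ^ (6 * t))) ^ (k + 1) := by
  have hsub : (regChoices n m t).filter (fun Γ => ¬ (inducedGraph Γ t).IsAcyclic) ⊆
      (range m).biUnion fun k => ((univ : Finset (Fin m)).powersetCard (k + 1)).biUnion fun S =>
        (regChoices n m t).filter fun Γ => (∀ v ∈ S, 6 * t ≤ rightDeg Γ v) ∧
          S.card ≤ (univ.filter fun x => 2 ≤ (Γ x ∩ S).card).card := by
    intro Γ hΓ
    obtain ⟨hreg, hcyc⟩ := Finset.mem_filter.mp hΓ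
    obtain ⟨S, hS, hdense⟩ := exists_dense_of_not_isAcyclic hcyc
    have hpos := hS.card_pos
    have hle : S.card ≤ m := by simpa using Finset.card_le_univ S
    simp only [Finset.mem_biUnion, Finset.mem_range]
    exact ⟨S.card - 1, by omega, S,
      Finset.mem_powersetCard.mpr ⟨Finset.subset_univ S, by omega⟩,
      Finset.mem_filter.mpr ⟨hreg, hdense⟩⟩
  rw [Finset.mul_sum]
  refine le_trans ?_ (Finset.sum_le_sum fun k _ => sum_card_dense_le ht htn hnm k.succ_pos)
  have := (Finset.card_le_card hsub).trans (Finset.card_biUnion_le.trans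
    (Finset.sum_le_sum fun k _ => Finset.card_biUnion_le))
  exact_mod_cast this

theorem sum_range_pow_succ_le {q : ℝ} (h0 : 0 ≤ q) (h1 : q ≤ 1 / 2) (m : ℕ) :
    ∑ k ∈ range m, q ^ (k + 1) ≤ 2 * q := by
  have h := mul_neg_geom_sum q m
  have hpos : 0 ≤ ∑ k ∈ range m, q ^ k := Finset.sum_nonneg fun k _ => by positivity
  have hm : 0 ≤ q ^ m := by positivity
  simp only [pow_succ]
  rw [← Finset.sum_mul]
  nlinarith

theorem two_mul_pow_four_mul_two_pow_le_exp {t : ℕ} (ht : 55 ≤ t) :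
    2 * (t : ℝ) ^ 4 * 2 ^ t ≤ Real.exp t := by
  have he : (2.7182818283 : ℝ) < Real.exp 1 := Real.exp_one_gt_d9
  induction t, ht using Nat.le_induction with
  | base =>
    rw [← Real.exp_one_pow]
    refine le_trans ?_ (pow_le_pow_left₀ (by norm_num) he.le 55)
    norm_num
  | succ t ht ih =>
    have ht' : (55 : ℝ) ≤ t := by exact_mod_cast ht
    have hstep : ((t : ℝ) + 1) ^ 4 * 2 ≤ (t : ℝ) ^ 4 * 2.7 := by
      have : (t : ℝ) + 1 ≤ t * (56 / 55) := by linarith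
      calc ((t : ℝ) + 1) ^ 4 * 2 ≤ ((t : ℝ) * (56 / 55)) ^ 4 * 2 := by gcongr
        _ = (t : ℝ) ^ 4 * ((56 / 55) ^ 4 * 2) := by ring
        _ ≤ (t : ℝ) ^ 4 * 2.7 := by gcongr; norm_num
    push_cast
    rw [Real.exp_add]
    calc 2 * ((t : ℝ) + 1) ^ 4 * 2 ^ (t + 1)
        = 2 * 2 ^ t * (((t : ℝ) + 1) ^ 4 * 2) := by ring
      _ ≤ 2 * 2 ^ t * ((t : ℝ) ^ 4 * 2.7) := by gcongr
      _ = (2 * (t : ℝ) ^ 4 * 2 ^ t) * 2.7 := by ring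
      _ ≤ Real.exp t * Real.exp 1 := by gcongr; linarith

theorem four_mul_sq_mul_exp_le {t : ℕ} (ht : 55 ≤ t) :
    4 * (t : ℝ) ^ 2 * (Real.exp (t + 2) / 2 ^ (6 * t)) ≤ t ^ 4 * Real.exp (-t) := by
  have he : Real.exp 1 < 2.7182818286 := Real.exp_one_lt_d9
  have he0 := Real.exp_pos 1
  have ht' : (55 : ℝ) ≤ t := by exact_mod_cast ht
  have hsq : Real.exp 1 ^ 2 ≤ 9 := by nlinarith
  have hpow : Real.exp t * Real.exp t ≤ 2 ^ (6 * t) := by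
    rw [← Real.exp_one_pow, ← mul_pow, pow_mul]
    exact pow_le_pow_left₀ (by positivity) (by nlinarith) t
  rw [Real.exp_neg, Real.exp_add, show (2 : ℝ) = (2 : ℕ) * 1 by norm_num, Real.exp_nat_mul,
    ← mul_div_assoc, ← div_eq_mul_inv]
  norm_num only [Nat.cast_ofNat, mul_one]
  rw [div_le_div_iff₀ (by positivity) (Real.exp_pos _)]
  calc 4 * (t : ℝ) ^ 2 * (Real.exp t * Real.exp 1 ^ 2) * Real.exp t
      = (t : ℝ) ^ 2 * (4 * Real.exp 1 ^ 2) * (Real.exp t * Real.exp t) := by ring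
    _ ≤ (t : ℝ) ^ 2 * t ^ 2 * 2 ^ (6 * t) := by gcongr; nlinarith
    _ = _ := by ring

/-- For `t ≥ 55` and `m ≥ n ≥ t`, the probability that the induced subgraph `G'`
contains a cycle is at most `2 t⁴ e^{-t}`, which is at most `2^{-t}`. -/
theorem prob_contains_cycle (t m n : ℕ) (ht : 55 ≤ t) (htn : t ≤ n) (hnm : n ≤ m) :
    (((regChoices n m t).filter fun Γ => ¬ (inducedGraph Γ t).IsAcyclic).card : ℝ)
        / (regChoices n m t).card
      ≤ 2 * (t : ℝ) ^ 4 * Real.exp (-(t : ℝ)) ∧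
    2 * (t : ℝ) ^ 4 * Real.exp (-(t : ℝ)) ≤ (2 : ℝ) ^ (-(t : ℤ)) := by
  have hsecond : 2 * (t : ℝ) ^ 4 * Real.exp (-(t : ℝ)) ≤ (2 : ℝ) ^ (-(t : ℤ)) := by
    rw [Real.exp_neg, zpow_neg, zpow_natCast, ← div_eq_mul_inv, ← one_div,
      div_le_div_iff₀ (Real.exp_pos _) (by positivity), one_mul]
    exact two_mul_pow_four_mul_two_pow_le_exp ht
  refine ⟨?_, hsecond⟩
  have hq := four_mul_sq_mul_exp_le ht
  have hone : (2 : ℝ) ^ (-(t : ℤ)) ≤ 1 := zpow_le_one_of_nonpos₀ (by norm_num) (by simp)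
  have hmain := card_not_isAcyclic_le (by omega) htn hnm
  refine div_le_of_le_mul₀ (by positivity) (by positivity) (hmain.trans ?_)
  rw [mul_comm]
  gcongr
  refine (sum_range_pow_succ_le (by positivity) (by linarith) m).trans ?_
  linarith
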